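/- arXiv:2005.05588 — 14 statements merged into one kernel-verified Lean document; each statement's English description precedes it below -/
import Mathlib

section
/- Consider the quantum prisoner's dilemma with no entanglement (θ=0). For all pure quantum strategies x_A=(α_A,β_A,γ_A,δ_A), x_B=(α_B,β_B,γ_B,δ_B) in S³, Alice's payoff satisfies $_A(x_A,x_B) = r(α_A²+δ_A²)(α_B²+δ_B²) + p(β_A²+γ_A²)(β_B²+γ_B²) + t(β_A²+γ_A²)(α_B²+δ_B²) + s(α_A²+δ_A²)(β_B²+γ_B²). Consequently, any pair (x_A,x_B) with α_A=δ_A=α_B=δ_B=0 is a Nash equilibrium, at which both players receive payoff p. -/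
open Matrix Kronecker

noncomputable section

/-- Pauli X matrix. -/
def pauliX : Matrix (Fin 2) (Fin 2) ℂ := !![0, 1; 1, 0]
/-- Pauli Y matrix. -/
def pauliY : Matrix (Fin 2) (Fin 2) ℂ := !![0, -Complex.I; Complex.I, 0]
/-- Pauli Z matrix. -/
def pauliZ : Matrix (Fin 2) (Fin 2) ℂ := !![1, 0; 0, -1]

/-- The entangling operator J = cos(θ/2)·I₄ + i sin(θ/2)·(Y⊗Y). -/
def Jmat (θ : ℝ) : Matrix (Fin 2 × Fin 2) (Fin 2 × Fin 2) ℂ :=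
  (Real.cos (θ / 2) : ℂ) • 1 + (Complex.I * Real.sin (θ / 2)) • (pauliY ⊗ₖ pauliY)

/-- The strategy unitary U(x) = α·I + i(β·X + γ·Y + δ·Z) encoded by x = (α,β,γ,δ). -/
def Umat (x : Fin 4 → ℝ) : Matrix (Fin 2) (Fin 2) ℂ :=
  (x 0 : ℂ) • 1 + Complex.I •
    ((x 1 : ℂ) • pauliX + (x 2 : ℂ) • pauliY + (x 3 : ℂ) • pauliZ)

/-- The initial state |CC⟩. -/
def ketCC : Fin 2 × Fin 2 → ℂ := fun i => if i = (0, 0) then 1 else 0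

/-- The final state |ψ⟩ = J†(U(x_A)⊗U(x_B))J|CC⟩. -/
def gameState (θ : ℝ) (xA xB : Fin 4 → ℝ) : Fin 2 × Fin 2 → ℂ :=
  ((Jmat θ)ᴴ * (Umat xA ⊗ₖ Umat xB) * Jmat θ).mulVec ketCC

/-- Alice's payoff: r|⟨CC|ψ⟩|² + s|⟨CD|ψ⟩|² + t|⟨DC|ψ⟩|² + p|⟨DD|ψ⟩|². -/
def payoffA (t r p s θ : ℝ) (xA xB : Fin 4 → ℝ) : ℝ :=
  r * Complex.normSq (gameState θ xA xB (0, 0))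
  + s * Complex.normSq (gameState θ xA xB (0, 1))
  + t * Complex.normSq (gameState θ xA xB (1, 0))
  + p * Complex.normSq (gameState θ xA xB (1, 1))

/-- Bob's payoff: r|⟨CC|ψ⟩|² + t|⟨CD|ψ⟩|² + s|⟨DC|ψ⟩|² + p|⟨DD|ψ⟩|². -/
def payoffB (t r p s θ : ℝ) (xA xB : Fin 4 → ℝ) : ℝ :=
  r * Complex.normSq (gameState θ xA xB (0, 0))
  + t * Complex.normSq (gameState θ xA xB (0, 1))
  + s * Complex.normSq (gameState θ xA xB (1, 0))
  + p * Complex.normSq (gameState θ xA xB (1, 1))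

/-- A pure strategy lies on the unit sphere S³ ⊂ ℝ⁴. -/
def onSphere (x : Fin 4 → ℝ) : Prop :=
  x 0 ^ 2 + x 1 ^ 2 + x 2 ^ 2 + x 3 ^ 2 = 1

/-- Nash equilibrium for the pure-strategy quantum game. -/
def PureNashEq (t r p s θ : ℝ) (xA xB : Fin 4 → ℝ) : Prop :=
  (∀ y, onSphere y → payoffA t r p s θ y xB ≤ payoffA t r p s θ xA xB) ∧
  (∀ y, onSphere y → payoffB t r p s θ xA y ≤ payoffB t r p s θ xA xB)

lemma gameState_zero (xA xB : Fin 4 → ℝ) (i j : Fin 2) :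
    gameState 0 xA xB (i, j) = Umat xA i 0 * Umat xB j 0 := by
  have hJ : Jmat 0 = 1 := by simp [Jmat]
  rw [gameState, hJ]
  simp [ketCC, mulVec, dotProduct]

lemma normSq_Umat_zero_zero (x : Fin 4 → ℝ) :
    Complex.normSq (Umat x 0 0) = x 0 ^ 2 + x 3 ^ 2 := by
  simp [Umat, pauliX, pauliY, pauliZ, Complex.normSq_apply]
  ring

lemma normSq_Umat_one_zero (x : Fin 4 → ℝ) :
    Complex.normSq (Umat x 1 0) = x 1 ^ 2 + x 2 ^ 2 := by
  simp [Umat, pauliX, pauliY, pauliZ, Complex.normSq_apply]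
  ring

lemma payoffA_zero (t r p s : ℝ) (xA xB : Fin 4 → ℝ) :
    payoffA t r p s 0 xA xB =
      r * (xA 0 ^ 2 + xA 3 ^ 2) * (xB 0 ^ 2 + xB 3 ^ 2)
      + p * (xA 1 ^ 2 + xA 2 ^ 2) * (xB 1 ^ 2 + xB 2 ^ 2)
      + t * (xA 1 ^ 2 + xA 2 ^ 2) * (xB 0 ^ 2 + xB 3 ^ 2)
      + s * (xA 0 ^ 2 + xA 3 ^ 2) * (xB 1 ^ 2 + xB 2 ^ 2) := by
  simp only [payoffA, gameState_zero, Complex.normSq_mul, normSq_Umat_zero_zero,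
    normSq_Umat_one_zero]
  ring

/-- Without entanglement the game is symmetric under exchange of the players. -/
lemma payoffB_zero_eq_payoffA_swap (t r p s : ℝ) (xA xB : Fin 4 → ℝ) :
    payoffB t r p s 0 xA xB = payoffA t r p s 0 xB xA := by
  simp only [payoffA, payoffB, gameState_zero, Complex.normSq_mul]
  ring

lemma onSphere.sq_add_sq_eq_one {x : Fin 4 → ℝ} (hx : onSphere x) (h0 : x 0 = 0)
    (h3 : x 3 = 0) : x 1 ^ 2 + x 2 ^ 2 = 1 := by
  simpa [onSphere, h0, h3] using hx

/-- Against a defecting opponent, the payoff lies between `s` and `p`, weighted by cooperation. -/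
lemma payoffA_zero_of_defect (t r p s : ℝ) {xA xB : Fin 4 → ℝ} (hB : onSphere xB)
    (hB0 : xB 0 = 0) (hB3 : xB 3 = 0) :
    payoffA t r p s 0 xA xB = p * (xA 1 ^ 2 + xA 2 ^ 2) + s * (xA 0 ^ 2 + xA 3 ^ 2) := by
  rw [payoffA_zero, hB.sq_add_sq_eq_one hB0 hB3, hB0, hB3]
  ring

lemma payoffA_zero_le_of_defect {p s : ℝ} (t r : ℝ) (hps : s ≤ p) {xA xB : Fin 4 → ℝ}
    (hA : onSphere xA) (hB : onSphere xB) (hB0 : xB 0 = 0) (hB3 : xB 3 = 0) :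
    payoffA t r p s 0 xA xB ≤ p := by
  rw [payoffA_zero_of_defect t r p s hB hB0 hB3]
  unfold onSphere at hA
  have hD : xA 1 ^ 2 + xA 2 ^ 2 = 1 - (xA 0 ^ 2 + xA 3 ^ 2) := by linarith
  rw [hD]
  nlinarith [mul_nonneg (sub_nonneg.2 hps) (add_nonneg (sq_nonneg (xA 0)) (sq_nonneg (xA 3)))]

lemma payoffA_zero_eq_of_defect (t r p s : ℝ) {xA xB : Fin 4 → ℝ}
    (hA : onSphere xA) (hB : onSphere xB) (hA0 : xA 0 = 0) (hA3 : xA 3 = 0)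
    (hB0 : xB 0 = 0) (hB3 : xB 3 = 0) :
    payoffA t r p s 0 xA xB = p := by
  rw [payoffA_zero_of_defect t r p s hB hB0 hB3, hA.sq_add_sq_eq_one hA0 hA3, hA0, hA3]
  ring

/-- with no entanglement (θ = 0), Alice's payoff has the classical
mixed-strategy form, and any pair of strategies with α = δ = 0 for both players is a
Nash equilibrium at which both players receive payoff p. -/
theorem stmt_0 (t r p s : ℝ) (ht : t > r) (hr : r > p) (hp : p > s) (hs : s ≥ 0) :
    (∀ xA xB : Fin 4 → ℝ, onSphere xA → onSphere xB →
      payoffA t r p s 0 xA xB =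
        r * (xA 0 ^ 2 + xA 3 ^ 2) * (xB 0 ^ 2 + xB 3 ^ 2)
        + p * (xA 1 ^ 2 + xA 2 ^ 2) * (xB 1 ^ 2 + xB 2 ^ 2)
        + t * (xA 1 ^ 2 + xA 2 ^ 2) * (xB 0 ^ 2 + xB 3 ^ 2)
        + s * (xA 0 ^ 2 + xA 3 ^ 2) * (xB 1 ^ 2 + xB 2 ^ 2)) ∧
    (∀ xA xB : Fin 4 → ℝ, onSphere xA → onSphere xB →
      xA 0 = 0 → xA 3 = 0 → xB 0 = 0 → xB 3 = 0 →
      PureNashEq t r p s 0 xA xB ∧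
      payoffA t r p s 0 xA xB = p ∧ payoffB t r p s 0 xA xB = p) := by
  refine ⟨fun xA xB _ _ => payoffA_zero t r p s xA xB, ?_⟩
  intro xA xB hA hB hA0 hA3 hB0 hB3
  have hpA := payoffA_zero_eq_of_defect t r p s hA hB hA0 hA3 hB0 hB3
  have hpB : payoffB t r p s 0 xA xB = p := by
    rw [payoffB_zero_eq_payoffA_swap]
    exact payoffA_zero_eq_of_defect t r p s hB hA hB0 hB3 hA0 hA3
  refine ⟨⟨fun y hy => ?_, fun y hy => ?_⟩, hpA, hpB⟩
  · rw [hpA]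
    exact payoffA_zero_le_of_defect t r hp.le hy hB hB0 hB3
  · rw [hpB, payoffB_zero_eq_payoffA_swap]
    exact payoffA_zero_le_of_defect t r hp.le hy hA hA0 hA3
end
end

section
/- In the maximally entangled case θ=π/2, define for x_A,x_B∈S³: α' = α_Aα_B − δ_Aδ_B + β_Aγ_B + γ_Aβ_B, β' = β_Aβ_B − γ_Aγ_B + α_Aδ_B + δ_Aα_B, γ' = γ_Aα_B + β_Aδ_B − α_Aβ_B + δ_Aγ_B, δ' = γ_Bα_A + β_Bδ_A − α_Bβ_A + δ_Bγ_A. Then (α')² + (β')² + (γ')² + (δ')² = 1 and Alice's payoff satisfies $_A(x_A,x_B) = r(α')² + p(β')² + t(γ')² + s(δ')². -/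
open Matrix Kronecker

noncomputable section

/-- At maximal entanglement every amplitude of the final state is real, and is bilinear in the
two strategies. -/
theorem gameState_pi_div_two (xA xB : Fin 4 → ℝ) :
    gameState (Real.pi / 2) xA xB (0, 0) =
        ((xA 0 * xB 0 - xA 3 * xB 3 + xA 1 * xB 2 + xA 2 * xB 1 : ℝ) : ℂ) ∧
    gameState (Real.pi / 2) xA xB (1, 1) =
        ((-(xA 1 * xB 1 - xA 2 * xB 2 + xA 0 * xB 3 + xA 3 * xB 0) : ℝ) : ℂ) ∧
    gameState (Real.pi / 2) xA xB (1, 0) =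
        ((-(xA 2 * xB 0 + xA 1 * xB 3 - xA 0 * xB 1 + xA 3 * xB 2) : ℝ) : ℂ) ∧
    gameState (Real.pi / 2) xA xB (0, 1) =
        ((-(xB 2 * xA 0 + xB 1 * xA 3 - xB 0 * xA 1 + xB 3 * xA 2) : ℝ) : ℂ) := by
  have half : Real.pi / 2 / 2 = Real.pi / 4 := by ring
  have sqrt_sq : ((Real.sqrt 2 : ℝ) : ℂ) ^ 2 = 2 := by
    rw [← Complex.ofReal_pow, Real.sq_sqrt zero_le_two, Complex.ofReal_ofNat]
  have I_pow_five : Complex.I ^ 5 = Complex.I := by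
    rw [pow_succ, Complex.I_pow_four, one_mul]
  have I_pow_six : Complex.I ^ 6 = -1 := by
    rw [pow_succ, I_pow_five, Complex.I_mul_I]
  refine ⟨?_, ?_, ?_, ?_⟩ <;>
  · simp [gameState, Jmat, Umat, ketCC, pauliX, pauliY, pauliZ, half, Matrix.mulVec, dotProduct,
      Matrix.mul_apply, Fintype.sum_prod_type, Matrix.one_apply, Complex.conj_ofReal,
      -Complex.ofReal_cos, -Complex.ofReal_sin]
    ring_nf
    simp only [sqrt_sq, Complex.I_sq, Complex.I_pow_three, Complex.I_pow_four, I_pow_five,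
      I_pow_six]
    ring

/-- in the maximally entangled case θ = π/2, the transformed coordinates
(α',β',γ',δ') lie on S³ and Alice's payoff is r(α')² + p(β')² + t(γ')² + s(δ')². -/
theorem stmt_1 (t r p s : ℝ) (ht : t > r) (hr : r > p) (hp : p > s) (hs : s ≥ 0)
    (xA xB : Fin 4 → ℝ) (hA : onSphere xA) (hB : onSphere xB) :
    let α' := xA 0 * xB 0 - xA 3 * xB 3 + xA 1 * xB 2 + xA 2 * xB 1
    let β' := xA 1 * xB 1 - xA 2 * xB 2 + xA 0 * xB 3 + xA 3 * xB 0
    let γ' := xA 2 * xB 0 + xA 1 * xB 3 - xA 0 * xB 1 + xA 3 * xB 2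
    let δ' := xB 2 * xA 0 + xB 1 * xA 3 - xB 0 * xA 1 + xB 3 * xA 2
    α' ^ 2 + β' ^ 2 + γ' ^ 2 + δ' ^ 2 = 1 ∧
    payoffA t r p s (Real.pi / 2) xA xB =
      r * α' ^ 2 + p * β' ^ 2 + t * γ' ^ 2 + s * δ' ^ 2 := by
  intro α' β' γ' δ'
  obtain ⟨hCC, hDD, hDC, hCD⟩ := gameState_pi_div_two xA xB
  unfold onSphere at hA hB
  refine ⟨?_, ?_⟩
  · calc α' ^ 2 + β' ^ 2 + γ' ^ 2 + δ' ^ 2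
        = (xA 0 ^ 2 + xA 1 ^ 2 + xA 2 ^ 2 + xA 3 ^ 2) *
            (xB 0 ^ 2 + xB 1 ^ 2 + xB 2 ^ 2 + xB 3 ^ 2) := by ring
      _ = 1 := by rw [hA, hB, one_mul]
  · rw [payoffA, hCC, hCD, hDC, hDD]
    simp only [Complex.normSq_ofReal]
    ring
end
end

section
/- In the maximally entangled mixed-strategy game (θ=π/2), if p^B is the uniform probability vector (1/4,1/4,1/4,1/4), then $_A(p^A,p^B) = (r+t+s+p)/4 for every probability vector p^A. Consequently the pair (p^A*,p^B*) with p^A* = p^B* = (1/4,1/4,1/4,1/4) is a Nash equilibrium, with both players receiving payoff (r+t+s+p)/4. -/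
open Matrix Real

noncomputable section

/-- The payoff matrix A(θ) of the mixed-strategy quantum prisoner's dilemma,
with rows/columns indexed by the operators I, X, Y, Z. -/
def Amat (t r p s θ : ℝ) : Matrix (Fin 4) (Fin 4) ℝ :=
  !![r, s * cos θ ^ 2 + t * sin θ ^ 2, s, r * cos θ ^ 2 + p * sin θ ^ 2;
     t * cos θ ^ 2 + s * sin θ ^ 2, p, p * cos θ ^ 2 + r * sin θ ^ 2, t;
     t, p * cos θ ^ 2 + r * sin θ ^ 2, p, t * cos θ ^ 2 + s * sin θ ^ 2;
     r * cos θ ^ 2 + p * sin θ ^ 2, s, s * cos θ ^ 2 + t * sin θ ^ 2, r]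

/-- A mixed quantum strategy: a probability vector over {I, X, Y, Z}. -/
def ProbVec (q : Fin 4 → ℝ) : Prop := (∀ i, 0 ≤ q i) ∧ ∑ i, q i = 1

/-- Alice's expected payoff $_A(p^A, p^B) = (p^A)ᵀ A(θ) p^B. -/
def payA (t r p s θ : ℝ) (pA pB : Fin 4 → ℝ) : ℝ :=
  pA ⬝ᵥ (Amat t r p s θ).mulVec pB

/-- Bob's expected payoff $_B(p^A, p^B) = $_A(p^B, p^A). -/
def payB (t r p s θ : ℝ) (pA pB : Fin 4 → ℝ) : ℝ :=
  payA t r p s θ pB pA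

/-- Nash equilibrium of the mixed-strategy quantum game. -/
def MixedNashEq (t r p s θ : ℝ) (pA pB : Fin 4 → ℝ) : Prop :=
  (∀ q, ProbVec q → payA t r p s θ q pB ≤ payA t r p s θ pA pB) ∧
  (∀ q, ProbVec q → payB t r p s θ pA q ≤ payB t r p s θ pA pB)

/-- At maximal entanglement every row of the payoff matrix is a permutation of the four payoffs,
so its product with the uniform strategy is constant. -/
theorem Amat_pi_div_two_mulVec_uniform (t r p s : ℝ) :
    (Amat t r p s (π / 2)).mulVec ![1/4, 1/4, 1/4, 1/4] = fun _ => (r + t + s + p) / 4 := by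
  ext i
  fin_cases i <;> simp [Amat, Matrix.mulVec, dotProduct, Fin.sum_univ_four] <;> ring

theorem payA_pi_div_two_uniform (t r p s : ℝ) {q : Fin 4 → ℝ} (hq : ProbVec q) :
    payA t r p s (π / 2) q ![1/4, 1/4, 1/4, 1/4] = (r + t + s + p) / 4 := by
  rw [payA, Amat_pi_div_two_mulVec_uniform, dotProduct, ← Finset.sum_mul, hq.2, one_mul]

theorem probVec_uniform : ProbVec ![1/4, 1/4, 1/4, 1/4] := by
  refine ⟨fun i => ?_, ?_⟩
  · fin_cases i <;> norm_num
  · simp [Fin.sum_univ_succ]; norm_num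

/-- at θ = π/2, against the uniform strategy Alice's payoff is always
(r+t+s+p)/4, and the pair of uniform strategies is a Nash equilibrium with both
payoffs equal to (r+t+s+p)/4. -/
theorem stmt_4 (t r p s : ℝ) (ht : t > r) (hr : r > p) (hp : p > s) (hs : s ≥ 0) :
    let unif : Fin 4 → ℝ := ![1/4, 1/4, 1/4, 1/4]
    (∀ pA : Fin 4 → ℝ, ProbVec pA →
      payA t r p s (π / 2) pA unif = (r + t + s + p) / 4) ∧
    MixedNashEq t r p s (π / 2) unif unif ∧
    payA t r p s (π / 2) unif unif = (r + t + s + p) / 4 ∧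
    payB t r p s (π / 2) unif unif = (r + t + s + p) / 4 := by
  intro unif
  have hpay (q : Fin 4 → ℝ) (hq : ProbVec q) :
      payA t r p s (π / 2) q unif = (r + t + s + p) / 4 :=
    payA_pi_div_two_uniform t r p s hq
  have hunif := hpay unif probVec_uniform
  have hle (q : Fin 4 → ℝ) (hq : ProbVec q) :
      payA t r p s (π / 2) q unif ≤ payA t r p s (π / 2) unif unif :=
    ((hpay q hq).trans hunif.symm).le
  exact ⟨hpay, ⟨hle, hle⟩, hunif, hunif⟩
end
end

section
/- In the maximally entangled mixed-strategy game (θ=π/2), if t+s > r+p, then both pairs (p^A*,p^B*) = ((0,1/2,1/2,0),(1/2,0,0,1/2)) and (p^A*,p^B*) = ((1/2,0,0,1/2),(0,1/2,1/2,0)) are Nash equilibria, and at each of these equilibria both players receive average payoff (t+s)/2. -/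
open Matrix Real

noncomputable section

/-- The payoff of a strategy `q` against the uniform mixture of `I` and `Z` at `θ = π / 2`. -/
lemma payA_pi_div_two_uniform_IZ (t r p s : ℝ) (q : Fin 4 → ℝ) :
    payA t r p s (π / 2) q ![1/2, 0, 0, 1/2] =
      (q 0 + q 3) * ((r + p) / 2) + (q 1 + q 2) * ((t + s) / 2) := by
  simp [payA, Amat, dotProduct, mulVec, Fin.sum_univ_four]
  ring

/-- The payoff of a strategy `q` against the uniform mixture of `X` and `Y` at `θ = π / 2`. -/
lemma payA_pi_div_two_uniform_XY (t r p s : ℝ) (q : Fin 4 → ℝ) :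
    payA t r p s (π / 2) q ![0, 1/2, 1/2, 0] =
      (q 1 + q 2) * ((r + p) / 2) + (q 0 + q 3) * ((t + s) / 2) := by
  simp [payA, Amat, dotProduct, mulVec, Fin.sum_univ_four]
  ring

lemma payA_pi_div_two_uniform_IZ_le {t r p s : ℝ} (hts : r + p ≤ t + s) {q : Fin 4 → ℝ}
    (hq : ProbVec q) : payA t r p s (π / 2) q ![1/2, 0, 0, 1/2] ≤ (t + s) / 2 := by
  obtain ⟨hpos, hsum⟩ := hq
  rw [Fin.sum_univ_four] at hsum
  rw [payA_pi_div_two_uniform_IZ]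
  have hq' : q 1 + q 2 = 1 - (q 0 + q 3) := by linarith
  rw [hq']
  nlinarith [mul_nonneg (add_nonneg (hpos 0) (hpos 3)) (sub_nonneg.2 hts)]

lemma payA_pi_div_two_uniform_XY_le {t r p s : ℝ} (hts : r + p ≤ t + s) {q : Fin 4 → ℝ}
    (hq : ProbVec q) : payA t r p s (π / 2) q ![0, 1/2, 1/2, 0] ≤ (t + s) / 2 := by
  obtain ⟨hpos, hsum⟩ := hq
  rw [Fin.sum_univ_four] at hsum
  rw [payA_pi_div_two_uniform_XY]
  have hq' : q 0 + q 3 = 1 - (q 1 + q 2) := by linarith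
  rw [hq']
  nlinarith [mul_nonneg (add_nonneg (hpos 1) (hpos 2)) (sub_nonneg.2 hts)]

/-- at θ = π/2, if t+s > r+p, then ((0,1/2,1/2,0),(1/2,0,0,1/2)) and
((1/2,0,0,1/2),(0,1/2,1/2,0)) are Nash equilibria with both payoffs (t+s)/2. -/
theorem stmt_5 (t r p s : ℝ) (ht : t > r) (hr : r > p) (hp : p > s) (hs : s ≥ 0)
    (hts : t + s > r + p) :
    let pXY : Fin 4 → ℝ := ![0, 1/2, 1/2, 0]
    let pIZ : Fin 4 → ℝ := ![1/2, 0, 0, 1/2]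
    (MixedNashEq t r p s (π / 2) pXY pIZ ∧
      payA t r p s (π / 2) pXY pIZ = (t + s) / 2 ∧
      payB t r p s (π / 2) pXY pIZ = (t + s) / 2) ∧
    (MixedNashEq t r p s (π / 2) pIZ pXY ∧
      payA t r p s (π / 2) pIZ pXY = (t + s) / 2 ∧
      payB t r p s (π / 2) pIZ pXY = (t + s) / 2) := by
  intro pXY pIZ
  have hXY : payA t r p s (π / 2) pXY pIZ = (t + s) / 2 := by
    rw [payA_pi_div_two_uniform_IZ]
    simp [pXY]
    ring
  have hIZ : payA t r p s (π / 2) pIZ pXY = (t + s) / 2 := by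
    rw [payA_pi_div_two_uniform_XY]
    simp [pIZ]
    ring
  have hbestXY : ∀ q, ProbVec q →
      payA t r p s (π / 2) q pIZ ≤ payA t r p s (π / 2) pXY pIZ :=
    fun q hq => hXY ▸ payA_pi_div_two_uniform_IZ_le hts.le hq
  have hbestIZ : ∀ q, ProbVec q →
      payA t r p s (π / 2) q pXY ≤ payA t r p s (π / 2) pIZ pXY :=
    fun q hq => hIZ ▸ payA_pi_div_two_uniform_XY_le hts.le hq
  exact ⟨⟨⟨hbestXY, hbestIZ⟩, hXY, hIZ⟩, ⟨hbestIZ, hbestXY⟩, hIZ, hXY⟩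
end
end

section
/- Suppose s=0 and sin²θ < p/(t−r+p). Then for every φ∈[0,2π], the pair of pure quantum strategies x_A* = (0, cos φ, sin φ, 0), x_B* = (0, sin φ, cos φ, 0) is a Nash equilibrium of the pure-strategy quantum prisoner's dilemma with entanglement θ, and the corresponding payoffs are $_A(x_A*,x_B*) = $_B(x_A*,x_B*) = r·sin²θ + p·cos²θ. -/
open Matrix Kronecker

noncomputable section

lemma gameState_apply_zero_zero (θ : ℝ) (x y : Fin 4 → ℝ) :
    gameState θ x y (0, 0) =
      Real.cos (θ / 2) * (Real.cos (θ / 2) * (Umat x 0 0 * Umat y 0 0)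
        - Complex.I * Real.sin (θ / 2) * (Umat x 0 1 * Umat y 0 1))
      + Complex.I * Real.sin (θ / 2) * (Real.cos (θ / 2) * (Umat x 1 0 * Umat y 1 0)
        - Complex.I * Real.sin (θ / 2) * (Umat x 1 1 * Umat y 1 1)) := by
  simp [gameState, Jmat, ketCC, pauliY, mulVec, dotProduct, Matrix.mul_apply,
    Fintype.sum_prod_type, Matrix.one_apply,
    -Complex.ofReal_cos, -Complex.ofReal_sin]
  ring

lemma gameState_apply_zero_one (θ : ℝ) (x y : Fin 4 → ℝ) :
    gameState θ x y (0, 1) =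
      Real.cos (θ / 2) * (Real.cos (θ / 2) * (Umat x 0 0 * Umat y 1 0)
        - Complex.I * Real.sin (θ / 2) * (Umat x 0 1 * Umat y 1 1))
      - Complex.I * Real.sin (θ / 2) * (Real.cos (θ / 2) * (Umat x 1 0 * Umat y 0 0)
        - Complex.I * Real.sin (θ / 2) * (Umat x 1 1 * Umat y 0 1)) := by
  simp [gameState, Jmat, ketCC, pauliY, mulVec, dotProduct, Matrix.mul_apply,
    Fintype.sum_prod_type, Matrix.one_apply,
    -Complex.ofReal_cos, -Complex.ofReal_sin]
  ring

lemma gameState_apply_one_zero (θ : ℝ) (x y : Fin 4 → ℝ) :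
    gameState θ x y (1, 0) =
      Real.cos (θ / 2) * (Real.cos (θ / 2) * (Umat x 1 0 * Umat y 0 0)
        - Complex.I * Real.sin (θ / 2) * (Umat x 1 1 * Umat y 0 1))
      - Complex.I * Real.sin (θ / 2) * (Real.cos (θ / 2) * (Umat x 0 0 * Umat y 1 0)
        - Complex.I * Real.sin (θ / 2) * (Umat x 0 1 * Umat y 1 1)) := by
  simp [gameState, Jmat, ketCC, pauliY, mulVec, dotProduct, Matrix.mul_apply,
    Fintype.sum_prod_type, Matrix.one_apply,
    -Complex.ofReal_cos, -Complex.ofReal_sin]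
  ring

lemma gameState_apply_one_one (θ : ℝ) (x y : Fin 4 → ℝ) :
    gameState θ x y (1, 1) =
      Real.cos (θ / 2) * (Real.cos (θ / 2) * (Umat x 1 0 * Umat y 1 0)
        - Complex.I * Real.sin (θ / 2) * (Umat x 1 1 * Umat y 1 1))
      + Complex.I * Real.sin (θ / 2) * (Real.cos (θ / 2) * (Umat x 0 0 * Umat y 0 0)
        - Complex.I * Real.sin (θ / 2) * (Umat x 0 1 * Umat y 0 1)) := by
  simp [gameState, Jmat, ketCC, pauliY, mulVec, dotProduct, Matrix.mul_apply,
    Fintype.sum_prod_type, Matrix.one_apply,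
    -Complex.ofReal_cos, -Complex.ofReal_sin]
  ring

/-- The game is symmetric under exchanging the two players. -/
lemma payoffB_eq_payoffA_swap (t r p s θ : ℝ) (x y : Fin 4 → ℝ) :
    payoffB t r p s θ x y = payoffA t r p s θ y x := by
  simp only [payoffA, payoffB, gameState_apply_zero_zero, gameState_apply_zero_one,
    gameState_apply_one_zero, gameState_apply_one_one, mul_comm (Umat x _ _)]
  ring

/-- Payoff, for `s = 0`, against an opponent who plays in the `X`-`Y` plane. -/
lemma payoffA_planar (t r p θ a b : ℝ) (hab : a ^ 2 + b ^ 2 = 1) (x : Fin 4 → ℝ) :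
    payoffA t r p 0 θ x ![0, a, b, 0] =
      p * (x 1 ^ 2 + x 2 ^ 2) + Real.sin θ ^ 2 *
        ((r - p) * (x 1 * b + x 2 * a) ^ 2 + t * (x 0 * a - x 3 * b) ^ 2) := by
  have hθ : Real.sin θ = 2 * Real.sin (θ / 2) * Real.cos (θ / 2) := by
    rw [← Real.sin_two_mul, mul_div_cancel₀ θ two_ne_zero]
  have hcs := Real.sin_sq_add_cos_sq (θ / 2)
  rw [hθ]
  simp only [payoffA, gameState_apply_zero_zero, gameState_apply_zero_one,
    gameState_apply_one_zero, gameState_apply_one_one]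
  simp only [Umat, pauliX, pauliY, pauliZ]
  generalize Real.sin (θ / 2) = k at *
  generalize Real.cos (θ / 2) = c at *
  simp [Complex.normSq_apply]
  linear_combination p * (x 1 ^ 2 + x 2 ^ 2) *
    ((k ^ 2 + c ^ 2) ^ 2 * hab + (k ^ 2 + c ^ 2 + 1) * hcs)

lemma payoffA_planar_le {t r p θ a b : ℝ} (ht : 0 ≤ t) (hrp : p ≤ r) (hab : a ^ 2 + b ^ 2 = 1)
    (hsin : Real.sin θ ^ 2 * (t - r + p) ≤ p) {x : Fin 4 → ℝ} (hx : onSphere x) :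
    payoffA t r p 0 θ x ![0, a, b, 0] ≤ r * Real.sin θ ^ 2 + p * Real.cos θ ^ 2 := by
  rw [payoffA_planar t r p θ a b hab, Real.cos_sq']
  unfold onSphere at hx
  have hu : (x 1 * b + x 2 * a) ^ 2 ≤ x 1 ^ 2 + x 2 ^ 2 := by
    linear_combination sq_nonneg (x 1 * a - x 2 * b) + (x 1 ^ 2 + x 2 ^ 2) * hab
  have hv : (x 0 * a - x 3 * b) ^ 2 ≤ x 0 ^ 2 + x 3 ^ 2 := by
    linear_combination sq_nonneg (x 0 * b + x 3 * a) + (x 0 ^ 2 + x 3 ^ 2) * hab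
  calc
    _ ≤ p * (x 1 ^ 2 + x 2 ^ 2) + Real.sin θ ^ 2 *
        ((r - p) * (x 1 ^ 2 + x 2 ^ 2) + t * (x 0 ^ 2 + x 3 ^ 2)) := by
      have := sub_nonneg.2 hrp
      gcongr
    _ ≤ _ := by
      have := mul_le_mul_of_nonneg_right hsin (add_nonneg (sq_nonneg (x 0)) (sq_nonneg (x 3)))
      linear_combination this + (p + Real.sin θ ^ 2 * (r - p)) * hx

lemma payoffA_planar_reflected (t r p θ a b : ℝ) (hab : a ^ 2 + b ^ 2 = 1) :
    payoffA t r p 0 θ ![0, b, a, 0] ![0, a, b, 0] =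
      r * Real.sin θ ^ 2 + p * Real.cos θ ^ 2 := by
  rw [payoffA_planar t r p θ a b hab, Real.cos_sq']
  simp
  linear_combination (p + Real.sin θ ^ 2 * (r - p) * (a ^ 2 + b ^ 2 + 1)) * hab

/-- for s = 0 and sin²θ < p/(t−r+p), each pair
x_A* = (0, cos φ, sin φ, 0), x_B* = (0, sin φ, cos φ, 0) is a Nash equilibrium,
with payoffs r·sin²θ + p·cos²θ for both players. -/
theorem stmt_7 (t r p s θ : ℝ) (ht : t > r) (hr : r > p) (hp : p > s) (hs : s ≥ 0)
    (hθ0 : 0 ≤ θ) (hθ1 : θ ≤ Real.pi / 2)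
    (hs0 : s = 0) (hsin : Real.sin θ ^ 2 < p / (t - r + p))
    (φ : ℝ) (hφ0 : 0 ≤ φ) (hφ1 : φ ≤ 2 * Real.pi) :
    let xA : Fin 4 → ℝ := ![0, Real.cos φ, Real.sin φ, 0]
    let xB : Fin 4 → ℝ := ![0, Real.sin φ, Real.cos φ, 0]
    PureNashEq t r p s θ xA xB ∧
    payoffA t r p s θ xA xB = r * Real.sin θ ^ 2 + p * Real.cos θ ^ 2 ∧
    payoffB t r p s θ xA xB = r * Real.sin θ ^ 2 + p * Real.cos θ ^ 2 := by
  intro xA xB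
  subst hs0
  have hsin' : Real.sin θ ^ 2 * (t - r + p) ≤ p :=
    ((lt_div_iff₀ (by linarith)).1 hsin).le
  have ht0 : 0 ≤ t := by linarith
  have hA := payoffA_planar_reflected t r p θ _ _ (Real.sin_sq_add_cos_sq φ)
  have hB := payoffA_planar_reflected t r p θ _ _ (Real.cos_sq_add_sin_sq φ)
  rw [← payoffB_eq_payoffA_swap] at hB
  refine ⟨⟨fun y hy ↦ ?_, fun y hy ↦ ?_⟩, hA, hB⟩
  · exact (payoffA_planar_le ht0 hr.le (Real.sin_sq_add_cos_sq φ) hsin' hy).trans_eq hA.symm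
  · rw [payoffB_eq_payoffA_swap]
    exact (payoffA_planar_le ht0 hr.le (Real.cos_sq_add_sin_sq φ) hsin' hy).trans_eq hB.symm
end
end

section
/- Suppose s=0 and sin²θ > p/(t−r+p). Then the pure-strategy quantum prisoner's dilemma with entanglement θ has no Nash equilibrium: there is no pair (x_A*,x_B*)∈S³×S³ such that $_A(x_A,x_B*) ≤ $_A(x_A*,x_B*) for all x_A∈S³ and $_B(x_A*,x_B) ≤ $_B(x_A*,x_B*) for all x_B∈S³. -/
open Matrix Kronecker

noncomputable section

/-- The rotation matrix `R` with `U(x)† σᵢ U(x) = ∑ⱼ Rᵢⱼ σⱼ` for a unit vector `x`. -/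
def strategyRotation (x : Fin 4 → ℝ) : Matrix (Fin 3) (Fin 3) ℝ :=
  !![x 0 ^ 2 + x 1 ^ 2 - x 2 ^ 2 - x 3 ^ 2, 2 * (x 1 * x 2 + x 0 * x 3),
      2 * (x 1 * x 3 - x 0 * x 2);
    2 * (x 1 * x 2 - x 0 * x 3), x 0 ^ 2 - x 1 ^ 2 + x 2 ^ 2 - x 3 ^ 2,
      2 * (x 2 * x 3 + x 0 * x 1);
    2 * (x 1 * x 3 + x 0 * x 2), 2 * (x 2 * x 3 - x 0 * x 1),
      x 0 ^ 2 - x 1 ^ 2 - x 2 ^ 2 + x 3 ^ 2]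

/-- The correlation `⟨σᵢ ⊗ σⱼ⟩` of the rotated entangled state, where `S = -sin θ`. -/
def corr (S : ℝ) (x y : Fin 4 → ℝ) (i j : Fin 3) : ℝ :=
  S * (strategyRotation x i 0 * strategyRotation y j 1
      + strategyRotation x i 1 * strategyRotation y j 0)
    + strategyRotation x i 2 * strategyRotation y j 2

/-- The payoff of the player choosing `x`, up to an increasing affine normalization. -/
def gain (k L S : ℝ) (x y : Fin 4 → ℝ) : ℝ :=
  k * corr S x y 2 2 - ((1 - S ^ 2) * strategyRotation x 2 2 + S * corr S x y 0 1)
    + L * ((1 - S ^ 2) * strategyRotation y 2 2 + S * corr S x y 1 0)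

lemma corr_swap (S : ℝ) (x y : Fin 4 → ℝ) (i j : Fin 3) : corr S x y i j = corr S y x j i := by
  simp only [corr]; ring

lemma strategyRotation_mul_transpose {x : Fin 4 → ℝ} (hx : onSphere x) :
    strategyRotation x * (strategyRotation x)ᵀ = 1 := by
  unfold onSphere at hx
  have h2 : (x 0 ^ 2 + x 1 ^ 2 + x 2 ^ 2 + x 3 ^ 2) ^ 2 = 1 := by rw [hx]; norm_num
  ext i j
  fin_cases i <;> fin_cases j <;>
    simp [strategyRotation, Matrix.mul_apply, Fin.sum_univ_three] <;>
    first | ring1 | linear_combination h2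

lemma sum_strategyRotation_row {x : Fin 4 → ℝ} (hx : onSphere x) (i j : Fin 3) :
    strategyRotation x i 0 * strategyRotation x j 0
      + strategyRotation x i 1 * strategyRotation x j 1
      + strategyRotation x i 2 * strategyRotation x j 2 = if i = j then 1 else 0 := by
  have h := congrFun (congrFun (strategyRotation_mul_transpose hx) i) j
  simpa [Matrix.mul_apply, Fin.sum_univ_three, Matrix.one_apply] using h

lemma sum_strategyRotation_col {x : Fin 4 → ℝ} (hx : onSphere x) (i j : Fin 3) :
    strategyRotation x 0 i * strategyRotation x 0 j
      + strategyRotation x 1 i * strategyRotation x 1 j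
      + strategyRotation x 2 i * strategyRotation x 2 j = if i = j then 1 else 0 := by
  have h0 : (strategyRotation x)ᵀ * strategyRotation x = 1 :=
    mul_eq_one_comm.mp (strategyRotation_mul_transpose hx)
  have h := congrFun (congrFun h0 i) j
  simpa [Matrix.mul_apply, Fin.sum_univ_three, Matrix.one_apply] using h

/-- The rows of `strategyRotation x` form a positively oriented frame. -/
lemma strategyRotation_cross {x : Fin 4 → ℝ} (hx : onSphere x) :
    crossProduct (strategyRotation x 1) (strategyRotation x 2) = strategyRotation x 0 ∧
    crossProduct (strategyRotation x 2) (strategyRotation x 0) = strategyRotation x 1 ∧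
    crossProduct (strategyRotation x 0) (strategyRotation x 1) = strategyRotation x 2 := by
  unfold onSphere at hx
  refine ⟨?_, ?_, ?_⟩ <;> ext i <;> fin_cases i <;> simp [strategyRotation, cross_apply]
  · linear_combination (x 0 ^ 2 + x 1 ^ 2 - x 2 ^ 2 - x 3 ^ 2) * hx
  · linear_combination (2 * (x 1 * x 2 + x 0 * x 3)) * hx
  · linear_combination (2 * (x 1 * x 3 - x 0 * x 2)) * hx
  · linear_combination (2 * (x 1 * x 2 - x 0 * x 3)) * hx
  · linear_combination (x 0 ^ 2 - x 1 ^ 2 + x 2 ^ 2 - x 3 ^ 2) * hx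
  · linear_combination (2 * (x 2 * x 3 + x 0 * x 1)) * hx
  · linear_combination (2 * (x 1 * x 3 + x 0 * x 2)) * hx
  · linear_combination (2 * (x 2 * x 3 - x 0 * x 1)) * hx
  · linear_combination (x 0 ^ 2 - x 1 ^ 2 - x 2 ^ 2 + x 3 ^ 2) * hx

lemma corr_mul_transpose (S : ℝ) {x y : Fin 4 → ℝ} (hx : onSphere x) (hy : onSphere y)
    (i j : Fin 3) :
    corr S x y i 0 * corr S x y j 0 + corr S x y i 1 * corr S x y j 1
      + corr S x y i 2 * corr S x y j 2
      = (if i = j then S ^ 2 else 0)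
        + (1 - S ^ 2) * (strategyRotation x i 2 * strategyRotation x j 2) := by
  have h00 := sum_strategyRotation_col hy 0 0
  have h01 := sum_strategyRotation_col hy 0 1
  have h02 := sum_strategyRotation_col hy 0 2
  have h11 := sum_strategyRotation_col hy 1 1
  have h12 := sum_strategyRotation_col hy 1 2
  have h22 := sum_strategyRotation_col hy 2 2
  have hr := sum_strategyRotation_row hx i j
  have hif : (if i = j then S ^ 2 else 0) = S ^ 2 * (if i = j then (1 : ℝ) else 0) := by
    split_ifs <;> simp
  rw [hif, ← hr]
  simp at h00 h01 h02 h11 h12 h22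
  simp only [corr]
  linear_combination S ^ 2 * strategyRotation x i 1 * strategyRotation x j 1 * h00
    + S ^ 2 * strategyRotation x i 0 * strategyRotation x j 0 * h11
    + strategyRotation x i 2 * strategyRotation x j 2 * h22
    + S ^ 2 * (strategyRotation x i 0 * strategyRotation x j 1
      + strategyRotation x i 1 * strategyRotation x j 0) * h01
    + S * (strategyRotation x i 1 * strategyRotation x j 2
      + strategyRotation x i 2 * strategyRotation x j 1) * h02
    + S * (strategyRotation x i 0 * strategyRotation x j 2
      + strategyRotation x i 2 * strategyRotation x j 0) * h12

lemma corr_mulVec (S : ℝ) (x : Fin 4 → ℝ) {y : Fin 4 → ℝ} (hy : onSphere y) (i : Fin 3) :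
    corr S x y i 0 * strategyRotation y 0 2 + corr S x y i 1 * strategyRotation y 1 2
      + corr S x y i 2 * strategyRotation y 2 2 = strategyRotation x i 2 := by
  have h02 := sum_strategyRotation_col hy 0 2
  have h12 := sum_strategyRotation_col hy 1 2
  have h22 := sum_strategyRotation_col hy 2 2
  simp at h02 h12 h22
  simp only [corr]
  linear_combination S * strategyRotation x i 1 * h02 + S * strategyRotation x i 0 * h12
    + strategyRotation x i 2 * h22

/-- The third column of the cofactor matrix of `corr S x y`. -/
lemma corr_cofactor (S : ℝ) {x y : Fin 4 → ℝ} (hx : onSphere x) (hy : onSphere y) :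
    corr S x y 1 0 * corr S x y 2 1 - corr S x y 1 1 * corr S x y 2 0
      = (1 - S ^ 2) * (strategyRotation x 0 2 * strategyRotation y 2 2) - corr S x y 0 2 ∧
    corr S x y 2 0 * corr S x y 0 1 - corr S x y 2 1 * corr S x y 0 0
      = (1 - S ^ 2) * (strategyRotation x 1 2 * strategyRotation y 2 2) - corr S x y 1 2 ∧
    corr S x y 0 0 * corr S x y 1 1 - corr S x y 0 1 * corr S x y 1 0
      = (1 - S ^ 2) * (strategyRotation x 2 2 * strategyRotation y 2 2) - corr S x y 2 2 := by
  obtain ⟨h0, h1, h2⟩ := strategyRotation_cross hx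
  obtain ⟨-, -, g⟩ := strategyRotation_cross hy
  have g0 := congrFun g 0
  have g1 := congrFun g 1
  have g2 := congrFun g 2
  simp only [cross_apply] at h0 h1 h2 g0 g1 g2
  refine ⟨?_, ?_, ?_⟩
  · have a0 := congrFun h0 0
    have a1 := congrFun h0 1
    have a2 := congrFun h0 2
    simp at a0 a1 a2 g0 g1 g2
    simp only [corr]
    rw [← a0, ← a1, ← a2, ← g0, ← g1, ← g2]
    ring
  · have a0 := congrFun h1 0
    have a1 := congrFun h1 1
    have a2 := congrFun h1 2
    simp at a0 a1 a2 g0 g1 g2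
    simp only [corr]
    rw [← a0, ← a1, ← a2, ← g0, ← g1, ← g2]
    ring
  · have a0 := congrFun h2 0
    have a1 := congrFun h2 1
    have a2 := congrFun h2 2
    simp at a0 a1 a2 g0 g1 g2
    simp only [corr]
    rw [← a0, ← a1, ← a2, ← g0, ← g1, ← g2]
    ring

lemma stationary_of_rotation_le {A B : ℝ}
    (h : ∀ u v : ℝ, u ^ 2 + v ^ 2 = 1 → A * (u ^ 2 - v ^ 2) + B * (2 * u * v) ≤ A) :
    0 ≤ A ∧ B = 0 := by
  have hA : 0 ≤ A := by have := h 0 1 (by norm_num); linarith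
  refine ⟨hA, ?_⟩
  by_contra hB
  have hpos : 0 < (A + 1) ^ 2 + B ^ 2 := by positivity
  have hs := Real.sq_sqrt hpos.le
  set n := √((A + 1) ^ 2 + B ^ 2)
  have hn : n ^ 2 ≠ 0 := by rw [hs]; exact hpos.ne'
  have hn0 : n ≠ 0 := fun h0 => hn (by simp [h0])
  have := h ((A + 1) / n) (B / n) (by field_simp; linarith)
  have e : A * (((A + 1) / n) ^ 2 - (B / n) ^ 2) + B * (2 * ((A + 1) / n) * (B / n)) - A
      = 2 * B ^ 2 / n ^ 2 + A * (((A + 1) ^ 2 + B ^ 2) / n ^ 2 - 1) := by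
    field_simp; ring
  rw [← hs, div_self hn] at e
  have : 0 < 2 * B ^ 2 / n ^ 2 := by positivity
  linarith

/-- The effect on `strategyRotation x` of a further turn about each of the three axes. -/
lemma strategyRotation_turn (x : Fin 4 → ℝ) {u v : ℝ} (huv : u ^ 2 + v ^ 2 = 1) (j : Fin 3) :
    (strategyRotation ![u * x 0 + v * x 1, u * x 1 - v * x 0, u * x 2 - v * x 3,
        u * x 3 + v * x 2] 0 j = strategyRotation x 0 j ∧
      strategyRotation ![u * x 0 + v * x 1, u * x 1 - v * x 0, u * x 2 - v * x 3,
        u * x 3 + v * x 2] 1 j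
        = (u ^ 2 - v ^ 2) * strategyRotation x 1 j - 2 * u * v * strategyRotation x 2 j ∧
      strategyRotation ![u * x 0 + v * x 1, u * x 1 - v * x 0, u * x 2 - v * x 3,
        u * x 3 + v * x 2] 2 j
        = (u ^ 2 - v ^ 2) * strategyRotation x 2 j + 2 * u * v * strategyRotation x 1 j) ∧
    (strategyRotation ![u * x 0 - v * x 2, u * x 1 - v * x 3, u * x 2 + v * x 0,
        u * x 3 + v * x 1] 1 j = strategyRotation x 1 j ∧
      strategyRotation ![u * x 0 - v * x 2, u * x 1 - v * x 3, u * x 2 + v * x 0,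
        u * x 3 + v * x 1] 2 j
        = (u ^ 2 - v ^ 2) * strategyRotation x 2 j + 2 * u * v * strategyRotation x 0 j ∧
      strategyRotation ![u * x 0 - v * x 2, u * x 1 - v * x 3, u * x 2 + v * x 0,
        u * x 3 + v * x 1] 0 j
        = (u ^ 2 - v ^ 2) * strategyRotation x 0 j - 2 * u * v * strategyRotation x 2 j) ∧
    (strategyRotation ![u * x 0 + v * x 3, u * x 1 - v * x 2, u * x 2 + v * x 1,
        u * x 3 - v * x 0] 2 j = strategyRotation x 2 j ∧
      strategyRotation ![u * x 0 + v * x 3, u * x 1 - v * x 2, u * x 2 + v * x 1,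
        u * x 3 - v * x 0] 0 j
        = (u ^ 2 - v ^ 2) * strategyRotation x 0 j - 2 * u * v * strategyRotation x 1 j ∧
      strategyRotation ![u * x 0 + v * x 3, u * x 1 - v * x 2, u * x 2 + v * x 1,
        u * x 3 - v * x 0] 1 j
        = (u ^ 2 - v ^ 2) * strategyRotation x 1 j + 2 * u * v * strategyRotation x 0 j) := by
  refine ⟨⟨?_, ?_, ?_⟩, ⟨?_, ?_, ?_⟩, ⟨?_, ?_, ?_⟩⟩
  · rw [← one_mul (strategyRotation x 0 j), ← huv]
    fin_cases j <;> simp [strategyRotation] <;> ring1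
  · fin_cases j <;> simp [strategyRotation] <;> ring1
  · fin_cases j <;> simp [strategyRotation] <;> ring1
  · rw [← one_mul (strategyRotation x 1 j), ← huv]
    fin_cases j <;> simp [strategyRotation] <;> ring1
  · fin_cases j <;> simp [strategyRotation] <;> ring1
  · fin_cases j <;> simp [strategyRotation] <;> ring1
  · rw [← one_mul (strategyRotation x 2 j), ← huv]
    fin_cases j <;> simp [strategyRotation] <;> ring1
  · fin_cases j <;> simp [strategyRotation] <;> ring1
  · fin_cases j <;> simp [strategyRotation] <;> ring1

/-- First- and second-order consequences of `x` being a best response to `y`. -/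
lemma bestResponse_conditions {k L S : ℝ} {x y : Fin 4 → ℝ} (hx : onSphere x)
    (hbest : ∀ z, onSphere z → gain k L S z y ≤ gain k L S x y) :
    k * corr S x y 1 2 - L * S * corr S x y 2 0 = (1 - S ^ 2) * strategyRotation x 1 2 ∧
    k * corr S x y 0 2 + S * corr S x y 2 1 = (1 - S ^ 2) * strategyRotation x 0 2 ∧
    S * (corr S x y 1 1 + L * corr S x y 0 0) = 0 ∧
    (1 - S ^ 2) * strategyRotation x 2 2 + S * corr S x y 0 1 ≤ k * corr S x y 2 2 ∧
    S * corr S x y 0 1 ≤ L * (S * corr S x y 1 0) := by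
  unfold onSphere at hx
  have hrow (u v : ℝ) (huv : u ^ 2 + v ^ 2 = 1) (j : Fin 3) := strategyRotation_turn x huv j
  have hX := stationary_of_rotation_le
    (A := k * corr S x y 2 2 - (1 - S ^ 2) * strategyRotation x 2 2 + L * (S * corr S x y 1 0))
    (B := k * corr S x y 1 2 - L * S * corr S x y 2 0 - (1 - S ^ 2) * strategyRotation x 1 2)
    (by
      intro u v huv
      have h := hbest ![u * x 0 + v * x 1, u * x 1 - v * x 0, u * x 2 - v * x 3,
        u * x 3 + v * x 2]
        (by simp [onSphere]; linear_combination (u ^ 2 + v ^ 2) * hx + huv)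
      simp only [gain, corr, (hrow u v huv _).1.1, (hrow u v huv _).1.2.1,
        (hrow u v huv _).1.2.2] at h
      simp only [corr]
      linear_combination h)
  have hY := stationary_of_rotation_le
    (A := k * corr S x y 2 2 - (1 - S ^ 2) * strategyRotation x 2 2 - S * corr S x y 0 1)
    (B := k * corr S x y 0 2 + S * corr S x y 2 1 - (1 - S ^ 2) * strategyRotation x 0 2)
    (by
      intro u v huv
      have h := hbest ![u * x 0 - v * x 2, u * x 1 - v * x 3, u * x 2 + v * x 0,
        u * x 3 + v * x 1]
        (by simp [onSphere]; linear_combination (u ^ 2 + v ^ 2) * hx + huv)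
      simp only [gain, corr, (hrow u v huv _).2.1.1, (hrow u v huv _).2.1.2.1,
        (hrow u v huv _).2.1.2.2] at h
      simp only [corr]
      linear_combination h)
  have hZ := stationary_of_rotation_le
    (A := L * (S * corr S x y 1 0) - S * corr S x y 0 1)
    (B := S * (corr S x y 1 1 + L * corr S x y 0 0))
    (by
      intro u v huv
      have h := hbest ![u * x 0 + v * x 3, u * x 1 - v * x 2, u * x 2 + v * x 1,
        u * x 3 - v * x 0]
        (by simp [onSphere]; linear_combination (u ^ 2 + v ^ 2) * hx + huv)
      simp only [gain, corr, (hrow u v huv _).2.2.1, (hrow u v huv _).2.2.2.1,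
        (hrow u v huv _).2.2.2.2] at h
      simp only [corr]
      linear_combination h)
  refine ⟨?_, ?_, hZ.2, ?_, ?_⟩ <;> linarith [hX.2, hY.1, hY.2, hZ.1]

/-- The opponent's strategy `y` always admits a counter-strategy that rules out the outcome in
which the responder alone cooperates. -/
lemma exists_counterStrategy {k L S : ℝ} (hL : 1 ≤ L) (y : Fin 4 → ℝ) (hy : onSphere y) :
    ∃ z, onSphere z ∧ 1 + (L - k) * strategyRotation y 2 2 ≤ gain k L S z y := by
  obtain ⟨m, n, u, hmn, hm, hn⟩ : ∃ m n u : ℝ, m ^ 2 + n ^ 2 = 1 ∧ y 3 = u * m ∧ y 0 = u * n := by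
    by_cases h : y 3 ^ 2 + y 0 ^ 2 = 0
    · exact ⟨0, 1, 0, by norm_num, by nlinarith [sq_nonneg (y 3), sq_nonneg (y 0)],
        by nlinarith [sq_nonneg (y 3), sq_nonneg (y 0)]⟩
    · have hu := Real.sq_sqrt (by positivity : 0 ≤ y 3 ^ 2 + y 0 ^ 2)
      set u := √(y 3 ^ 2 + y 0 ^ 2)
      have hu0 : u ≠ 0 := fun h0 => h (by rw [← hu, h0]; norm_num)
      refine ⟨y 3 / u, y 0 / u, u, ?_, ?_, ?_⟩ <;> field_simp
      exact hu.symm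
  refine ⟨![0, m, n, 0], by simpa [onSphere] using hmn, ?_⟩
  have hpos : 0 ≤ 2 * (L - 1) * (S * (n * y 1 + m * y 2)) ^ 2 := by
    have : 0 ≤ L - 1 := by linarith
    positivity
  unfold onSphere at hy
  simp only [gain, corr, strategyRotation, hm, hn] at hy ⊢
  simp
  linear_combination hpos + (k * (u ^ 2 * (m ^ 2 + n ^ 2) - y 1 ^ 2 - y 2 ^ 2) - (1 - S ^ 2)) * hmn
    - S ^ 2 * (m ^ 2 + n ^ 2) * hy - S ^ 2 * hmn
    - L * S ^ 2 * (u ^ 2 * (m ^ 2 + n ^ 2) - y 1 ^ 2 - y 2 ^ 2) * hmn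

/-- In an equilibrium the correlations in the bottom row vanish. -/
lemma corr_eq_zero_of_equilibrium {k L S : ℝ} {x y : Fin 4 → ℝ} (hL : 1 < L) (hk : -1 < k)
    (hk1 : k < 1) (hx : onSphere x) (hy : onSphere y)
    (hA : ∀ z, onSphere z → gain k L S z y ≤ gain k L S x y)
    (hB : ∀ z, onSphere z → gain k L S z x ≤ gain k L S y x) :
    corr S x y 2 0 = 0 ∧ corr S x y 2 1 = 0 := by
  obtain ⟨hA1, hA2, -, -, -⟩ := bestResponse_conditions hx hA
  obtain ⟨hB1, hB2, -, -, -⟩ := bestResponse_conditions hy hB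
  obtain ⟨z, hz, hgain⟩ := exists_counterStrategy (k := k) (S := S) hL.le y hy
  replace hgain := hgain.trans (hA z hz)
  have e0 := corr_mul_transpose S hy hx 0 2
  have e1 := corr_mul_transpose S hy hx 1 2
  have f0 := corr_mulVec S y hx 0
  have f1 := corr_mulVec S y hx 1
  obtain ⟨c0, c1, -⟩ := corr_cofactor S hx hy
  have hq : strategyRotation y 2 2 ^ 2 ≤ 1 := by
    have h := sum_strategyRotation_row hy 2 2
    simp only [if_true] at h
    nlinarith [sq_nonneg (strategyRotation y 2 0), sq_nonneg (strategyRotation y 2 1)]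
  simp only [corr_swap S y x] at e0 e1 f0 f1 hB1 hB2
  simp only [Fin.reduceEq, if_false, zero_add] at e0 e1
  simp only [gain] at hgain
  set P := corr S x y 2 0
  set Q := corr S x y 2 1
  set M := corr S x y 0 2
  set T := corr S x y 1 2
  set hxx := corr S x y 0 0
  set hyy := corr S x y 1 1
  set hxy := corr S x y 0 1
  set hyx := corr S x y 1 0
  set hzz := corr S x y 2 2
  set q := strategyRotation y 2 2
  set l := strategyRotation x 2 2
  set F := k * hzz - (1 - S ^ 2) * l - S * hxy + L * (S * hyx) + k - k ^ 2 * q - L * S ^ 2 * q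
    with hF
  have hFpos : 0 < F := by
    have hkq : k * q < 1 := by
      have := abs_le_of_sq_le_sq' (by simpa using hq : q ^ 2 ≤ 1 ^ 2) zero_le_one
      nlinarith
    have : 0 < (1 + k) * (1 - k * q) := mul_pos (by linarith) (by linarith)
    linarith
  have hP : F * P = 0 := by
    rw [hF]
    linear_combination -(1 - S ^ 2) * f0 - hxx * hA2 - hyx * hA1 + k * e0 + (1 - k * q) * hB2
      - S * c1 + S * q * hA1
  have hQ : F * Q = 0 := by
    rw [hF]
    linear_combination -(1 - S ^ 2) * f1 - hxy * hA2 - hyy * hA1 + k * e1 + (1 - k * q) * hB1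
      + L * S * c0 - L * S * q * hA2
  exact ⟨(mul_eq_zero.mp hP).resolve_left hFpos.ne', (mul_eq_zero.mp hQ).resolve_left hFpos.ne'⟩

/-- The normalized game has no equilibrium. -/
lemma not_equilibrium {k L S : ℝ} {x y : Fin 4 → ℝ} (hS : S ≠ 0) (hL : 1 < L)
    (hk : -1 < k) (hk1 : k < 2 * S ^ 2 - 1) (hS1 : S ^ 2 ≤ 1) (hx : onSphere x) (hy : onSphere y)
    (hA : ∀ z, onSphere z → gain k L S z y ≤ gain k L S x y)
    (hB : ∀ z, onSphere z → gain k L S z x ≤ gain k L S y x) : False := by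
  obtain ⟨hP, hQ⟩ := corr_eq_zero_of_equilibrium hL hk (by linarith) hx hy hA hB
  obtain ⟨hM, hT⟩ := corr_eq_zero_of_equilibrium hL hk (by linarith) hy hx hB hA
  obtain ⟨hA1, hA2, hA3, hA4, hA5⟩ := bestResponse_conditions hx hA
  obtain ⟨hB1, hB2, -, -, hB5⟩ := bestResponse_conditions hy hB
  simp only [corr_swap S y x] at hM hT hB1 hB2 hB5
  have hr := sum_strategyRotation_col hx 2 2
  have nz := corr_mul_transpose S hx hy 2 2
  have nx := corr_mul_transpose S hx hy 0 0
  have ny := corr_mul_transpose S hy hx 1 1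
  have mz := corr_mulVec S y hx 2
  obtain ⟨-, -, cz⟩ := corr_cofactor S hx hy
  simp only [corr_swap S y x] at ny mz
  simp only [if_true] at hr nz nx ny
  rw [hP, hQ] at nz
  rw [hM] at nx
  rw [hQ] at ny
  rw [hM, hT] at mz
  rw [hM, hQ] at hA2
  rw [hP, hT] at hA1 hB2
  rw [hM, hQ] at hB1
  have hyy : corr S x y 1 1 = -L * corr S x y 0 0 := by
    rcases mul_eq_zero.mp hA3 with h | h
    · exact absurd h hS
    · linarith
  have hX : 0 ≤ S * corr S x y 0 1 := by
    by_contra! h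
    linarith [mul_le_mul_of_nonneg_left hB5 (by linarith : 0 ≤ L),
      mul_pos_of_neg_of_neg h (by nlinarith only [hL] : 1 - L ^ 2 < 0)]
  have hY : 0 ≤ S * corr S x y 1 0 := by
    by_contra! h
    linarith [mul_neg_of_pos_of_neg (by linarith : 0 < L) h]
  have hl : (1 - S ^ 2) * strategyRotation x 2 2 ^ 2 = 1 - S ^ 2 := by
    linear_combination (1 - S ^ 2) * hr + strategyRotation x 0 2 * hA2
      + strategyRotation x 1 2 * hA1
  have hzz1 : corr S x y 2 2 ^ 2 = 1 := by linear_combination nz + hl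
  have hq : (1 - S ^ 2) * (strategyRotation x 2 2 * strategyRotation y 2 2)
      = (1 - S ^ 2) * corr S x y 2 2 := by
    linear_combination corr S x y 2 2 * hl - (1 - S ^ 2) * strategyRotation x 2 2 * mz
  have hS2 : 0 < S ^ 2 := by positivity
  have hdet : L * (S * corr S x y 0 0) ^ 2 + (S * corr S x y 0 1) * (S * corr S x y 1 0)
      = S ^ 4 * corr S x y 2 2 := by
    rw [hyy] at cz
    linear_combination -S ^ 2 * cz - S ^ 2 * hq
  have hzz : corr S x y 2 2 = 1 := by
    rcases sq_eq_one_iff.mp hzz1 with h | h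
    · exact h
    · rw [h] at hdet
      linarith [mul_nonneg hX hY,
        mul_nonneg (by linarith : 0 ≤ L) (sq_nonneg (S * corr S x y 0 0)), pow_pos hS2 2]
  have hxx : corr S x y 0 0 = 0 := by
    have h : (L ^ 2 - 1) * corr S x y 0 0 ^ 2 = 0 := by
      rw [hyy] at ny
      linear_combination ny - nx + strategyRotation x 0 2 * hA2 - strategyRotation y 1 2 * hB1
    rcases mul_eq_zero.mp h with h | h
    · nlinarith only [h, hL]
    · simpa using h
  have hXS : S * corr S x y 0 1 = S ^ 2 := by
    rw [hxx] at nx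
    have h : (S * corr S x y 0 1) ^ 2 = (S ^ 2) ^ 2 := by
      linear_combination S ^ 2 * nx - S ^ 2 * strategyRotation x 0 2 * hA2
    exact (sq_eq_sq₀ hX hS2.le).mp h
  rw [hzz, hXS] at hA4
  have hfac : (1 - S ^ 2) * ((strategyRotation x 2 2 - 1) * (strategyRotation x 2 2 + 1)) = 0 := by
    linear_combination hl
  rcases mul_eq_zero.mp hfac with h | h
  · rw [h] at hA4
    linarith
  · rcases mul_eq_zero.mp h with h | h
    · rw [sub_eq_zero.mp h] at hA4
      linarith
    · rw [eq_neg_of_add_eq_zero_left h] at hA4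
      linarith

/-- The outcome probabilities of the game. -/
lemma normSq_gameState (θ : ℝ) (x y : Fin 4 → ℝ) :
    Complex.normSq (gameState θ x y (0, 0))
      = (x 0 * y 0 - x 3 * y 3 + Real.sin θ * (x 2 * y 1 + x 1 * y 2)) ^ 2
        + (1 - Real.sin θ ^ 2) * (x 0 * y 3 + x 3 * y 0) ^ 2 ∧
    Complex.normSq (gameState θ x y (0, 1))
      = (x 0 * y 2 + x 3 * y 1 + Real.sin θ * (x 2 * y 3 - x 1 * y 0)) ^ 2
        + (1 - Real.sin θ ^ 2) * (x 3 * y 2 - x 0 * y 1) ^ 2 ∧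
    Complex.normSq (gameState θ x y (1, 0))
      = (x 2 * y 0 + x 1 * y 3 + Real.sin θ * (x 3 * y 2 - x 0 * y 1)) ^ 2
        + (1 - Real.sin θ ^ 2) * (x 2 * y 3 - x 1 * y 0) ^ 2 ∧
    Complex.normSq (gameState θ x y (1, 1))
      = (x 2 * y 2 - x 1 * y 1 - Real.sin θ * (x 0 * y 3 + x 3 * y 0)) ^ 2
        + (1 - Real.sin θ ^ 2) * (x 2 * y 1 + x 1 * y 2) ^ 2 := by
  have hsin : Real.sin θ = 2 * Real.sin (θ / 2) * Real.cos (θ / 2) := by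
    rw [← Real.sin_two_mul]; congr 1; ring
  have hcos : 1 - Real.sin θ ^ 2 = (Real.cos (θ / 2) ^ 2 - Real.sin (θ / 2) ^ 2) ^ 2 := by
    rw [← Real.cos_sq', ← Real.cos_two_mul']; congr 2; ring
  have h := Real.sin_sq_add_cos_sq (θ / 2)
  rw [hcos, hsin]
  simp only [gameState, Jmat]
  generalize Real.sin (θ / 2) = D at h
  generalize Real.cos (θ / 2) = C at h
  have key (a b : ℝ) : (a * (D ^ 2 + C ^ 2) + b) ^ 2 = (a + b) ^ 2 := by rw [h, mul_one]
  refine ⟨?_, ?_, ?_, ?_⟩ <;>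
    simp [Umat, pauliX, pauliY, pauliZ, ketCC, Matrix.mulVec, dotProduct, Matrix.mul_apply,
      Fintype.sum_prod_type, Fin.sum_univ_two, Matrix.one_apply, Complex.normSq_apply]
  · linear_combination key (x 0 * y 0 - x 3 * y 3) (2 * D * C * (x 2 * y 1 + x 1 * y 2))
  · linear_combination key (x 0 * y 2 + x 3 * y 1) (2 * D * C * (x 2 * y 3 - x 1 * y 0))
  · linear_combination key (x 2 * y 0 + x 1 * y 3) (2 * D * C * (x 3 * y 2 - x 0 * y 1))
  · linear_combination key (x 2 * y 2 - x 1 * y 1) (-(2 * D * C * (x 0 * y 3 + x 3 * y 0)))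

lemma payoffA_eq_gain {t r p s : ℝ} (θ : ℝ) (hK : t + p - r - s ≠ 0) {x y : Fin 4 → ℝ}
    (hx : onSphere x) (hy : onSphere y) :
    payoffA t r p s θ x y = (t + r + p + s) / 4 + (t + p - r - s) / 4 *
      gain ((r + p - t - s) / (t + p - r - s)) ((t + r - p - s) / (t + p - r - s))
        (-Real.sin θ) x y := by
  obtain ⟨h1, h2, h3, h4⟩ := normSq_gameState θ x y
  rw [payoffA, h1, h2, h3, h4]
  simp only [gain, corr, strategyRotation]
  unfold onSphere at hx hy
  simp
  field_simp
  generalize Real.sin θ = S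
  linear_combination (t + r + p + s) * ((x 0 ^ 2 + x 1 ^ 2 + x 2 ^ 2 + x 3 ^ 2) * hy + hx)
    - (t + p - r - s) * (1 - S ^ 2) * (x 0 ^ 2 - x 1 ^ 2 - x 2 ^ 2 + x 3 ^ 2) * hy
    + (t + r - p - s) * (1 - S ^ 2) * (y 0 ^ 2 - y 1 ^ 2 - y 2 ^ 2 + y 3 ^ 2) * hx

/-- for s = 0 and sin²θ > p/(t−r+p), the pure-strategy quantum
prisoner's dilemma with entanglement θ has no Nash equilibrium. -/
theorem stmt_8 (t r p s θ : ℝ) (ht : t > r) (hr : r > p) (hp : p > s) (hs : s ≥ 0)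
    (hθ0 : 0 ≤ θ) (hθ1 : θ ≤ Real.pi / 2)
    (hs0 : s = 0) (hsin : Real.sin θ ^ 2 > p / (t - r + p)) :
    ¬ ∃ xA xB : Fin 4 → ℝ, onSphere xA ∧ onSphere xB ∧
      PureNashEq t r p s θ xA xB := by
  rintro ⟨x, y, hx, hy, hA, hB⟩
  subst hs0
  have hK : 0 < t + p - r - 0 := by linarith
  have hS : 0 < Real.sin θ ^ 2 := (div_pos hp (by linarith)).trans hsin
  rw [gt_iff_lt, div_lt_iff₀ (by linarith)] at hsin
  refine not_equilibrium (k := (r + p - t - 0) / (t + p - r - 0))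
    (L := (t + r - p - 0) / (t + p - r - 0)) (S := -Real.sin θ) (x := x) (y := y)
    (neg_ne_zero.mpr fun h => by simp [h] at hS) ?_ ?_ ?_
    (by simpa using Real.sin_sq_le_one θ) hx hy ?_ ?_
  · rw [lt_div_iff₀ hK]; linarith
  · rw [lt_div_iff₀ hK]; linarith
  · rw [div_lt_iff₀ hK]; linarith
  · intro z hz
    have h := hA z hz
    rw [payoffA_eq_gain θ hK.ne' hz hy, payoffA_eq_gain θ hK.ne' hx hy] at h
    exact le_of_mul_le_mul_left (le_of_add_le_add_left h) (by positivity)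
  · intro z hz
    have h := hB z hz
    rw [payoffB_eq_payoffA_swap, payoffB_eq_payoffA_swap, payoffA_eq_gain θ hK.ne' hz hx,
      payoffA_eq_gain θ hK.ne' hy hx] at h
    exact le_of_mul_le_mul_left (le_of_add_le_add_left h) (by positivity)
end
end

section
/- Define t̄ = t·cos²θ + s·sin²θ, r̄ = r·cos²θ + p·sin²θ, p̄ = p·cos²θ + r·sin²θ, s̄ = s·cos²θ + t·sin²θ, and D = t + t̄ − r − r̄ − p − p̄ + s + s̄. Let p* = (p*_I, p*_X, p*_Y, p*_Z) with p*_I = p*_Z = (s + s̄ − p − p̄)/(2D) and p*_X = p*_Y = (t + t̄ − r − r̄)/(2D). Assume D ≠ 0, (s+s̄−p−p̄)/D ≥ 0 and (t+t̄−r−r̄)/D ≥ 0, so that p* is a probability vector. Then $_A(p^A, p*) = $_A(p*, p*) for every probability vector p^A, and (p*, p*) is a Nash equilibrium of the mixed-strategy game with entanglement θ. -/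
open Matrix Real

noncomputable section

theorem ProbVec.dotProduct_const {q : Fin 4 → ℝ} (hq : ProbVec q) (v : ℝ) :
    (q ⬝ᵥ fun _ => v) = v := by
  rw [dotProduct, ← Finset.sum_mul, hq.2, one_mul]

/-- A probability vector against which every pure strategy earns the same payoff forms a symmetric
equilibrium. -/
theorem payoff_const_and_mixedNashEq_of_mulVec_const {t r p s θ v : ℝ} {q : Fin 4 → ℝ}
    (hq : ProbVec q) (hv : (Amat t r p s θ).mulVec q = fun _ => v) :
    (∀ pA : Fin 4 → ℝ, ProbVec pA → payA t r p s θ pA q = payA t r p s θ q q) ∧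
      MixedNashEq t r p s θ q q := by
  have key : ∀ pA : Fin 4 → ℝ, ProbVec pA → payA t r p s θ pA q = payA t r p s θ q q := by
    intro pA hA
    rw [payA, payA, hv, hA.dotProduct_const, hq.dotProduct_const]
  exact ⟨key, fun pA hA => (key pA hA).le, fun pB hB => (key pB hB).le⟩

/-- the interior strategy p* (built from the barred payoffs) is a
probability vector, Alice's payoff against p* is constant, and (p*, p*) is a Nash
equilibrium of the mixed-strategy game with entanglement θ. -/
theorem stmt_9 (t r p s θ : ℝ) (ht : t > r) (hr : r > p) (hp : p > s) (hs : s ≥ 0)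
    (hθ0 : 0 ≤ θ) (hθ1 : θ ≤ π / 2) :
    let tb := t * cos θ ^ 2 + s * sin θ ^ 2
    let rb := r * cos θ ^ 2 + p * sin θ ^ 2
    let pb := p * cos θ ^ 2 + r * sin θ ^ 2
    let sb := s * cos θ ^ 2 + t * sin θ ^ 2
    let D := t + tb - r - rb - p - pb + s + sb
    let pstar : Fin 4 → ℝ :=
      ![(s + sb - p - pb) / (2 * D), (t + tb - r - rb) / (2 * D),
        (t + tb - r - rb) / (2 * D), (s + sb - p - pb) / (2 * D)]
    D ≠ 0 → (s + sb - p - pb) / D ≥ 0 → (t + tb - r - rb) / D ≥ 0 →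
    (ProbVec pstar ∧
     (∀ pA : Fin 4 → ℝ, ProbVec pA →
        payA t r p s θ pA pstar = payA t r p s θ pstar pstar) ∧
     MixedNashEq t r p s θ pstar pstar) := by
  intro tb rb pb sb D pstar hD ha hb
  have hhalf : ∀ x : ℝ, x / (2 * D) = x / D / 2 := fun x => by rw [div_div, mul_comm D]
  have hprob : ProbVec pstar := by
    constructor
    · intro i
      fin_cases i <;> simp only [pstar, hhalf] <;> exact div_nonneg ‹_› zero_le_two
    · have hsum : (s + sb - p - pb) / D + (t + tb - r - rb) / D = 1 := by
        rw [← add_div, div_eq_one_iff_eq hD]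
        ring
      simp only [pstar, Fin.sum_univ_four, hhalf, cons_val]
      linarith
  refine ⟨hprob, payoff_const_and_mixedNashEq_of_mulVec_const
    (v := (s + sb - p - pb) / (2 * D) * (r + rb) + (t + tb - r - rb) / (2 * D) * (s + sb))
    hprob ?_⟩
  ext i
  fin_cases i <;>
    simp [Amat, pstar, mulVec, dotProduct, Fin.sum_univ_four] <;> ring
end
end

section
/- Suppose t+s > r+p and sin²θ < 2(p−s)/(t−r+p−s). Then the pair (p^A*, p^B*) with p^A* = p^B* = (0, 1/2, 1/2, 0) is a Nash equilibrium of the mixed-strategy game with entanglement θ, and at this equilibrium each player's payoff equals (p + p·cos²θ + r·sin²θ)/2. -/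
open Matrix Real

noncomputable section

/-- Against the even mixture of X and Y, the payoff depends only on the weight given to
`{I, Z}` and the weight given to `{X, Y}`. -/
lemma payA_half_XY (t r p s θ : ℝ) (q : Fin 4 → ℝ) :
    payA t r p s θ q ![0, 1/2, 1/2, 0] =
      (q 0 + q 3) * ((s + s * cos θ ^ 2 + t * sin θ ^ 2) / 2) +
      (q 1 + q 2) * ((p + p * cos θ ^ 2 + r * sin θ ^ 2) / 2) := by
  simp [payA, Amat, dotProduct, Matrix.mulVec, Fin.sum_univ_four]
  ring

/-- if t+s > r+p and sin²θ < 2(p−s)/(t−r+p−s), then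
(p^A*, p^B*) = ((0,1/2,1/2,0),(0,1/2,1/2,0)) is a Nash equilibrium with both
payoffs (p + p·cos²θ + r·sin²θ)/2. -/
theorem stmt_10 (t r p s θ : ℝ) (ht : t > r) (hr : r > p) (hp : p > s) (hs : s ≥ 0)
    (hθ0 : 0 ≤ θ) (hθ1 : θ ≤ π / 2)
    (hts : t + s > r + p) (hsin : sin θ ^ 2 < 2 * (p - s) / (t - r + p - s)) :
    let pXY : Fin 4 → ℝ := ![0, 1/2, 1/2, 0]
    MixedNashEq t r p s θ pXY pXY ∧
    payA t r p s θ pXY pXY = (p + p * cos θ ^ 2 + r * sin θ ^ 2) / 2 ∧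
    payB t r p s θ pXY pXY = (p + p * cos θ ^ 2 + r * sin θ ^ 2) / 2 := by
  intro pXY
  have hval : payA t r p s θ pXY pXY = (p + p * cos θ ^ 2 + r * sin θ ^ 2) / 2 := by
    rw [payA_half_XY]
    simp [pXY]
    ring
  have hrow : (s + s * cos θ ^ 2 + t * sin θ ^ 2) / 2 ≤
      (p + p * cos θ ^ 2 + r * sin θ ^ 2) / 2 := by
    rw [lt_div_iff₀ (by linarith)] at hsin
    rw [cos_sq']
    linarith
  have hbest : ∀ q, ProbVec q → payA t r p s θ q pXY ≤ payA t r p s θ pXY pXY := by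
    rintro q ⟨hq, hsum⟩
    rw [Fin.sum_univ_four] at hsum
    rw [hval, payA_half_XY, show q 1 + q 2 = 1 - (q 0 + q 3) by linarith]
    linarith [mul_le_mul_of_nonneg_left hrow (add_nonneg (hq 0) (hq 3))]
  exact ⟨⟨hbest, hbest⟩, hval, hval⟩
end
end

section
/- Suppose t+s < r+p and sin²θ > 2(t−r)/(t−r+p−s). Then the pair (p^A*, p^B*) with p^A* = p^B* = (1/2, 0, 0, 1/2) is a Nash equilibrium of the mixed-strategy game with entanglement θ, and at this equilibrium each player's payoff equals (r + r·cos²θ + p·sin²θ)/2. -/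
open Matrix Real

noncomputable section

/-- The payoff of a strategy `q` against the equal mixture of `I` and `Z`. -/
theorem payA_halfIZ (t r p s θ : ℝ) (q : Fin 4 → ℝ) :
    payA t r p s θ q ![1/2, 0, 0, 1/2] =
      (q 0 + q 3) * ((r + r * cos θ ^ 2 + p * sin θ ^ 2) / 2) +
        (q 1 + q 2) * ((t + t * cos θ ^ 2 + s * sin θ ^ 2) / 2) := by
  simp [payA, Amat, dotProduct, Matrix.mulVec, Fin.sum_univ_four]
  ring

/-- if t+s < r+p and sin²θ > 2(t−r)/(t−r+p−s), then
((1/2,0,0,1/2),(1/2,0,0,1/2)) is a Nash equilibrium with both payoffs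
(r + r·cos²θ + p·sin²θ)/2. -/
theorem stmt_13 (t r p s θ : ℝ) (ht : t > r) (hr : r > p) (hp : p > s) (hs : s ≥ 0)
    (hθ0 : 0 ≤ θ) (hθ1 : θ ≤ π / 2)
    (hts : t + s < r + p) (hsin : sin θ ^ 2 > 2 * (t - r) / (t - r + p - s)) :
    let pIZ : Fin 4 → ℝ := ![1/2, 0, 0, 1/2]
    MixedNashEq t r p s θ pIZ pIZ ∧
    payA t r p s θ pIZ pIZ = (r + r * cos θ ^ 2 + p * sin θ ^ 2) / 2 ∧
    payB t r p s θ pIZ pIZ = (r + r * cos θ ^ 2 + p * sin θ ^ 2) / 2 := by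
  intro pIZ
  have hpay : payA t r p s θ pIZ pIZ = (r + r * cos θ ^ 2 + p * sin θ ^ 2) / 2 := by
    rw [payA_halfIZ]
    simp [pIZ]
    ring
  have hdev : (t + t * cos θ ^ 2 + s * sin θ ^ 2) / 2 ≤
      (r + r * cos θ ^ 2 + p * sin θ ^ 2) / 2 := by
    have h := (div_lt_iff₀ (by linarith : 0 < t - r + p - s)).mp hsin
    rw [cos_sq']
    linarith
  have hbest : ∀ q, ProbVec q → payA t r p s θ q pIZ ≤ payA t r p s θ pIZ pIZ := by
    rintro q ⟨hq, hsum⟩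
    rw [hpay, payA_halfIZ]
    rw [Fin.sum_univ_four] at hsum
    have h03 : q 0 + q 3 = 1 - (q 1 + q 2) := by linarith
    rw [h03]
    linarith [mul_le_mul_of_nonneg_left hdev (add_nonneg (hq 1) (hq 2))]
  exact ⟨⟨hbest, hbest⟩, hpay, hpay⟩
end
end

section
/- Suppose sin²θ·(t−r+p−s) < 2(p−s). Let p^B* = (0,1/2,1/2,0) and set m = (p + p·cos²θ + r·sin²θ)/2 and δ_inf = (t−r)/(t−m). Then: (i) $_A(p^A, p^B*) ≤ m for every probability vector p^A; (ii) 0 < δ_inf < 1; and (iii) for every δ with δ_inf < δ < 1, r/(1−δ) > t + (δ/(1−δ))·m. (This shows the grim-trigger cooperation value r/(1−δ) strictly exceeds the best one-shot deviation value followed by punishment, so Trigger 1 is an equilibrium of the repeated quantum prisoner's dilemma for such δ.) -/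
open Matrix Real

noncomputable section

/-- with punishment strategy p^B* = (0,1/2,1/2,0),
m = (p + p·cos²θ + r·sin²θ)/2 and δ_inf = (t−r)/(t−m): (i) Alice's payoff against
p^B* is at most m; (ii) 0 < δ_inf < 1; (iii) for δ_inf < δ < 1 the cooperation value
r/(1−δ) strictly exceeds t + (δ/(1−δ))·m, so Trigger 1 is an equilibrium. -/
theorem stmt_14 (t r p s θ : ℝ) (ht : t > r) (hr : r > p) (hp : p > s) (hs : s ≥ 0)
    (hθ0 : 0 ≤ θ) (hθ1 : θ ≤ π / 2)
    (hsin : sin θ ^ 2 * (t - r + p - s) < 2 * (p - s)) :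
    let pBstar : Fin 4 → ℝ := ![0, 1/2, 1/2, 0]
    let m := (p + p * cos θ ^ 2 + r * sin θ ^ 2) / 2
    let δinf := (t - r) / (t - m)
    (∀ pA : Fin 4 → ℝ, ProbVec pA → payA t r p s θ pA pBstar ≤ m) ∧
    (0 < δinf ∧ δinf < 1) ∧
    (∀ δ : ℝ, δinf < δ → δ < 1 → r / (1 - δ) > t + (δ / (1 - δ)) * m) := by
  intro pBstar m δinf
  have hcos : cos θ ^ 2 = 1 - sin θ ^ 2 := cos_sq' θ
  have hsin_le : sin θ ^ 2 ≤ 1 := sin_sq_le_one θ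
  have hm : m = p + (r - p) * sin θ ^ 2 / 2 := by
    simp only [m, hcos]
    ring
  have hmr : m < r := by
    rw [hm]
    nlinarith
  have htm : 0 < t - m := by linarith
  refine ⟨fun q hq => ?_, ⟨div_pos (by linarith) htm, ?_⟩, fun δ hδ hδ1 => ?_⟩
  · obtain ⟨hq0, hqsum⟩ := hq
    have hpay : payA t r p s θ q pBstar =
        m * ∑ i, q i - (q 0 + q 3) * (2 * (p - s) - sin θ ^ 2 * (t - r + p - s)) / 2 := by
      simp [payA, Amat, pBstar, hm, hcos, dotProduct, mulVec, Fin.sum_univ_four]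
      ring
    rw [hpay, hqsum]
    have h : 0 ≤ (q 0 + q 3) * (2 * (p - s) - sin θ ^ 2 * (t - r + p - s)) :=
      mul_nonneg (add_nonneg (hq0 0) (hq0 3)) (by linarith)
    linarith
  · rw [div_lt_one htm]
    linarith
  · have h1 : 0 < 1 - δ := by linarith
    have h2 : t - r < δ * (t - m) := (div_lt_iff₀ htm).mp hδ
    have h3 : t + δ / (1 - δ) * m = (t * (1 - δ) + δ * m) / (1 - δ) := by
      field_simp
    rw [gt_iff_lt, h3]
    exact div_lt_div_of_pos_right (by linarith) h1
end
end

section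
/- Suppose r > (t+p)/2 and fix θ∈[0,π/2]. Then there exists δ₀∈(0,1) such that for all δ with δ₀ < δ < 1: r/(1−δ) > t + ((δ/2)/(1−δ/2))·( p + (p·cos²θ + r·sin²θ)/(1−δ) ). (This is the no-profitable-deviation condition for deviation 1 in the Trigger 2 strategy of the repeated quantum prisoner's dilemma: the total payoff from perpetual cooperation exceeds the maximal expected payoff from deviating from cooperation and then entering the punishment phase.) -/
open Real

/-- for r > (t+p)/2 and any θ ∈ [0,π/2] there is δ₀ ∈ (0,1) such that
for all δ ∈ (δ₀,1) the no-profitable-deviation condition for deviation 1 of the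
Trigger 2 strategy holds:
r/(1−δ) > t + ((δ/2)/(1−δ/2))·(p + (p·cos²θ + r·sin²θ)/(1−δ)). -/
theorem stmt_15 (t r p s θ : ℝ) (ht : t > r) (hr : r > p) (hp : p > s) (hs : s ≥ 0)
    (hθ0 : 0 ≤ θ) (hθ1 : θ ≤ π / 2) (hcoop : r > (t + p) / 2) :
    ∃ δ₀ : ℝ, 0 < δ₀ ∧ δ₀ < 1 ∧ ∀ δ : ℝ, δ₀ < δ → δ < 1 →
      r / (1 - δ) >
        t + ((δ / 2) / (1 - δ / 2)) *
          (p + (p * cos θ ^ 2 + r * sin θ ^ 2) / (1 - δ)) := by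
  have htp : 0 < t - p := by linarith
  have hw : p * cos θ ^ 2 + r * sin θ ^ 2 ≤ r := by
    nlinarith [sin_sq_add_cos_sq θ, mul_nonneg (sub_nonneg.2 hr.le) (sq_nonneg (cos θ))]
  refine ⟨2 * (t - r) / (t - p), div_pos (by linarith) htp,
    (div_lt_one htp).2 (by linarith), fun δ hδ hδ1 => ?_⟩
  have hδ0 : 0 < δ := (div_pos (by linarith) htp).trans hδ
  rw [div_lt_iff₀ htp] at hδ
  have h1 : 0 < 1 - δ := by linarith
  have h2 : 0 < 2 - δ := by linarith
  have h3 : 1 - δ / 2 ≠ 0 := by linarith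
  generalize p * cos θ ^ 2 + r * sin θ ^ 2 = w at hw ⊢
  have key : r / (1 - δ) - (t + (δ / 2) / (1 - δ / 2) * (p + w / (1 - δ))) =
      ((1 - δ) * (δ * (t - p) - 2 * (t - r)) + δ * (r - w)) / ((1 - δ) * (2 - δ)) := by
    have h4 : (δ / 2) / (1 - δ / 2) = δ / (2 - δ) := by
      rw [div_eq_div_iff h3 h2.ne']
      ring
    rw [h4]
    field_simp
    ring
  refine sub_pos.1 (key ▸ div_pos ?_ (mul_pos h1 h2))
  exact add_pos_of_pos_of_nonneg (mul_pos h1 (by linarith))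
    (mul_nonneg hδ0.le (sub_nonneg.2 hw))
end

section
/- Suppose r > (t+p)/2 and fix θ∈[0,π/2]. For δ∈(0,1) let V(δ) = ((1/2)/(1−δ/2))·( p + (p·cos²θ + r·sin²θ)/(1−δ) ). Then there exists δ₀∈(0,1) such that for all δ with δ₀ < δ < 1: V(δ) > (s·cos²θ + t·sin²θ)/2 + δ·V(δ). (This is the no-profitable-deviation condition for deviation 2 in the Trigger 2 strategy: during the punishment phase a player cannot gain by choosing I or Z instead of randomizing equally over X and Y.) -/
open Real

/-- for r > (t+p)/2 and any θ ∈ [0,π/2], with punishment-phase value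
V(δ) = ((1/2)/(1−δ/2))·(p + (p·cos²θ + r·sin²θ)/(1−δ)), there is δ₀ ∈ (0,1) such
that for all δ ∈ (δ₀,1) the no-profitable-deviation condition for deviation 2 of
the Trigger 2 strategy holds: V(δ) > (s·cos²θ + t·sin²θ)/2 + δ·V(δ). -/
theorem stmt_16 (t r p s θ : ℝ) (ht : t > r) (hr : r > p) (hp : p > s) (hs : s ≥ 0)
    (hθ0 : 0 ≤ θ) (hθ1 : θ ≤ π / 2) (hcoop : r > (t + p) / 2) :
    let V : ℝ → ℝ := fun δ =>
      ((1 / 2) / (1 - δ / 2)) * (p + (p * cos θ ^ 2 + r * sin θ ^ 2) / (1 - δ))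
    ∃ δ₀ : ℝ, 0 < δ₀ ∧ δ₀ < 1 ∧ ∀ δ : ℝ, δ₀ < δ → δ < 1 →
      V δ > (s * cos θ ^ 2 + t * sin θ ^ 2) / 2 + δ * V δ := by
  intro V
  have hsc := sin_sq_add_cos_sq θ
  have hcos := sq_nonneg (cos θ)
  have hsin := sq_nonneg (sin θ)
  have hV : V = fun δ =>
      ((1 / 2) / (1 - δ / 2)) * (p + (p * cos θ ^ 2 + r * sin θ ^ 2) / (1 - δ)) := rfl
  have hB : 0 ≤ (s * cos θ ^ 2 + t * sin θ ^ 2) / 2 := by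
    have ht0 : 0 ≤ t := by linarith
    positivity
  have hAB : (s * cos θ ^ 2 + t * sin θ ^ 2) / 2 < p * cos θ ^ 2 + r * sin θ ^ 2 := by
    have hps : 0 < 2 * p - s := by linarith
    have hrt : 0 < 2 * r - t := by linarith
    rcases hcos.eq_or_lt with h | h
    · have hsin1 : sin θ ^ 2 = 1 := by linarith
      rw [← h, hsin1]
      linarith
    · nlinarith [mul_pos hps h, mul_nonneg hrt.le hsin]
  generalize p * cos θ ^ 2 + r * sin θ ^ 2 = A at hV hAB
  generalize (s * cos θ ^ 2 + t * sin θ ^ 2) / 2 = B at hB hAB ⊢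
  have hA : 0 < A + 1 := by linarith
  refine ⟨(B + 1) / (A + 1), by positivity, (div_lt_one hA).2 (by linarith), ?_⟩
  intro δ hδ hδ1
  rw [div_lt_iff₀ hA] at hδ
  have h1 : 0 < 1 - δ := by linarith
  have h2 : 0 < 2 - δ := by linarith
  have key : (1 - δ) * V δ = (p * (1 - δ) + A) / (2 - δ) := by
    have h3 : 1 - δ / 2 = (2 - δ) / 2 := by ring
    simp only [hV, h3]
    field_simp
  have hlt : B < (1 - δ) * V δ := by
    rw [key, lt_div_iff₀ h2]
    have hp0 : 0 < p := by linarith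
    nlinarith [mul_pos hp0 h1, mul_pos h1 (sub_pos.2 hAB)]
  linarith
end

section
/- Suppose r > (t+p)/2 and fix θ∈[0,π/2]. For δ∈(0,1) let V(δ) = ((1/2)/(1−δ/2))·( p + (p·cos²θ + r·sin²θ)/(1−δ) ). Then there exists δ₀∈(0,1) such that for all δ with δ₀ < δ < 1: (p·cos²θ + r·sin²θ)/(1−δ) > s·cos²θ + t·sin²θ + δ·V(δ). (This is the no-profitable-deviation condition for deviation 3 in the Trigger 2 strategy: a player who should repeat the asymmetric pair (X,Y) forever cannot gain by a one-shot deviation to I or Z followed by the mutual-randomization punishment phase.) -/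
open Real

/-- for r > (t+p)/2 and any θ ∈ [0,π/2], with punishment-phase value
V(δ) = ((1/2)/(1−δ/2))·(p + (p·cos²θ + r·sin²θ)/(1−δ)), there is δ₀ ∈ (0,1) such
that for all δ ∈ (δ₀,1) the no-profitable-deviation condition for deviation 3 of
the Trigger 2 strategy holds:
(p·cos²θ + r·sin²θ)/(1−δ) > s·cos²θ + t·sin²θ + δ·V(δ). -/
theorem stmt_17 (t r p s θ : ℝ) (ht : t > r) (hr : r > p) (hp : p > s) (hs : s ≥ 0)
    (hθ0 : 0 ≤ θ) (hθ1 : θ ≤ π / 2) (hcoop : r > (t + p) / 2) :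
    let V : ℝ → ℝ := fun δ =>
      ((1 / 2) / (1 - δ / 2)) * (p + (p * cos θ ^ 2 + r * sin θ ^ 2) / (1 - δ))
    ∃ δ₀ : ℝ, 0 < δ₀ ∧ δ₀ < 1 ∧ ∀ δ : ℝ, δ₀ < δ → δ < 1 →
      (p * cos θ ^ 2 + r * sin θ ^ 2) / (1 - δ) >
        s * cos θ ^ 2 + t * sin θ ^ 2 + δ * V δ := by
  intro V
  set M := p * cos θ ^ 2 + r * sin θ ^ 2 with hM
  set D := s * cos θ ^ 2 + t * sin θ ^ 2 with hD
  -- the condition is equivalent to `D * (2 - δ) + δ * p < 2 * M`, which is strict at `δ = 1`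
  have hgap : 0 < 2 * M - p - D := by
    have hsc := sin_sq_add_cos_sq θ
    have hsplit : 2 * M - p - D =
        (p - s) * cos θ ^ 2 + (2 * r - p - t) * sin θ ^ 2 := by
      rw [hM, hD]
      linear_combination p * hsc
    have h₁ : 0 < p - s := by linarith
    have h₂ : 0 < 2 * r - p - t := by linarith
    rw [hsplit]
    rcases (sq_nonneg (sin θ)).eq_or_lt with h | h
    · have hcos : cos θ ^ 2 = 1 := by linarith
      rw [← h, hcos]
      linarith
    · have := mul_pos h₂ h
      have := mul_nonneg h₁.le (sq_nonneg (cos θ))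
      linarith
  set ε := 2 * M - p - D with hε
  have hK : 0 < |D - p| + 1 := by positivity
  set K := |D - p| + 1 with hKdef
  have hKD : D - p ≤ K := by linarith [le_abs_self (D - p)]
  refine ⟨K / (ε + K), by positivity, by rw [div_lt_one (by positivity)]; linarith, ?_⟩
  intro δ hδ₀ hδ₁
  rw [div_lt_iff₀ (by positivity)] at hδ₀
  have h1δ : 0 < 1 - δ := by linarith
  have h2δ : 0 < 2 - δ := by linarith
  have hε_pos : (1 - δ) * (D - p) < ε := by
    have := mul_le_mul_of_nonneg_left hKD h1δ.le
    have := mul_lt_mul_of_pos_right hδ₁ hgap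
    linarith
  have hdiff : M / (1 - δ) - (D + δ * V δ) = (ε - (1 - δ) * (D - p)) / (2 - δ) := by
    have hhalf : 1 - δ / 2 = (2 - δ) / 2 := by ring
    simp only [V, hhalf, hε]
    field_simp
    ring
  have := div_pos (sub_pos.mpr hε_pos) h2δ
  linarith
end

section
/- In the maximally entangled mixed-strategy game (θ=π/2), Alice's mini-max value equals (r+t+s+p)/4; that is, for every probability vector p^B, max over probability vectors p^A of $_A(p^A,p^B) is at least (r+t+s+p)/4, and this bound is attained (with equality of the maximum) when p^B is the uniform vector (1/4,1/4,1/4,1/4). Hence min over p^B of max over p^A of $_A(p^A,p^B) = (r+t+s+p)/4. -/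
open Matrix Real

noncomputable section

/-- The payoff of the maximally entangled game, written out in coordinates. -/
theorem payA_pi_div_two (t r p s : ℝ) (pA pB : Fin 4 → ℝ) :
    payA t r p s (π / 2) pA pB =
      pA 0 * (r * pB 0 + t * pB 1 + s * pB 2 + p * pB 3) +
      pA 1 * (s * pB 0 + p * pB 1 + r * pB 2 + t * pB 3) +
      pA 2 * (t * pB 0 + r * pB 1 + p * pB 2 + s * pB 3) +
      pA 3 * (p * pB 0 + s * pB 1 + t * pB 2 + r * pB 3) := by
  simp [payA, Amat, Matrix.mulVec, dotProduct, Fin.sum_univ_four]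

/-- Every strategy of Alice earns the average payoff against uniform play by Bob. -/
theorem payA_uniform_right (t r p s : ℝ) {pA : Fin 4 → ℝ} (h : ProbVec pA) :
    payA t r p s (π / 2) pA ![1/4, 1/4, 1/4, 1/4] = (r + t + s + p) / 4 := by
  have hsum := h.2
  rw [Fin.sum_univ_four] at hsum
  simp only [payA_pi_div_two, Matrix.cons_val]
  linear_combination (r + t + s + p) / 4 * hsum

/-- Uniform play by Alice earns the average payoff against every strategy of Bob. -/
theorem payA_uniform_left (t r p s : ℝ) {pB : Fin 4 → ℝ} (h : ProbVec pB) :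
    payA t r p s (π / 2) ![1/4, 1/4, 1/4, 1/4] pB = (r + t + s + p) / 4 := by
  have hsum := h.2
  rw [Fin.sum_univ_four] at hsum
  simp only [payA_pi_div_two, Matrix.cons_val]
  linear_combination (r + t + s + p) / 4 * hsum

/-- at θ = π/2 Alice's mini-max value is (r+t+s+p)/4: against every
strategy of Bob, Alice can secure at least (r+t+s+p)/4, and against the uniform
strategy of Bob, Alice's payoff never exceeds (and attains) (r+t+s+p)/4. Hence
min over p^B of max over p^A of $_A(p^A,p^B) equals (r+t+s+p)/4. -/
theorem stmt_18 (t r p s : ℝ) (ht : t > r) (hr : r > p) (hp : p > s) (hs : s ≥ 0) :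
    let v := (r + t + s + p) / 4
    let unif : Fin 4 → ℝ := ![1/4, 1/4, 1/4, 1/4]
    (∀ pB : Fin 4 → ℝ, ProbVec pB → ∃ pA : Fin 4 → ℝ, ProbVec pA ∧
      v ≤ payA t r p s (π / 2) pA pB) ∧
    (∀ pA : Fin 4 → ℝ, ProbVec pA → payA t r p s (π / 2) pA unif ≤ v) ∧
    (∃ pA : Fin 4 → ℝ, ProbVec pA ∧ payA t r p s (π / 2) pA unif = v) := by
  exact ⟨fun _ hB => ⟨_, probVec_uniform, (payA_uniform_left t r p s hB).ge⟩,
    fun _ hA => (payA_uniform_right t r p s hA).le,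
    _, probVec_uniform, payA_uniform_right t r p s probVec_uniform⟩
end
end
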